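/- arXiv:1711.09244 — 2 statements merged into one kernel-verified Lean document; each statement's English description precedes it below -/
import Mathlib

section
/- Let 𝕁 be a separably determined operator ideal. If the complement ∁𝕁 admits a universal factoring operator (an operator U' ∉ 𝕁 factoring through every operator not in 𝕁), then there exists an operator U ∉ 𝕁 whose domain and codomain are separable Banach spaces and such that U factors through a restriction of every operator A ∉ 𝕁 whose domain and codomain are separable. Moreover, if 𝕁 is additionally injective, the converse holds: if there exists an operator U ∉ 𝕁 with separable domain and codomain which factors through a restriction of every member of ∁𝕁 with separable domain and codomain, then ∁𝕁 admits a universal factoring operator. -/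
/-!
STATEMENT 9: Let `J` be a separably determined operator ideal.  If the complement `∁J`
admits a universal factoring operator then there is an operator `U ∉ J` between separable
Banach spaces which factors through a restriction of every member of `∁J` with separable
domain and codomain.  Moreover, if `J` is injective, the converse holds.
-/

set_option synthInstance.maxHeartbeats 400000
set_option maxHeartbeats 1000000

noncomputable section

/-- A bundled real Banach space. -/
structure BanachSp : Type 1 where
  carrier : Type
  [nacg : NormedAddCommGroup carrier]
  [nsp : NormedSpace ℝ carrier]
  [cs : CompleteSpace carrier]

attribute [instance] BanachSp.nacg BanachSp.nsp BanachSp.cs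

/-- `A` factors through `B`: there are bounded operators `C`, `D` with `A = D ∘ B ∘ C`. -/
def FactorsThrough {X Y Z W : Type*} [NormedAddCommGroup X] [NormedSpace ℝ X]
    [NormedAddCommGroup Y] [NormedSpace ℝ Y] [NormedAddCommGroup Z] [NormedSpace ℝ Z]
    [NormedAddCommGroup W] [NormedSpace ℝ W]
    (A : X →L[ℝ] Y) (B : Z →L[ℝ] W) : Prop :=
  ∃ (C : X →L[ℝ] Z) (D : W →L[ℝ] Y), ∀ x, D (B (C x)) = A x

/-- `A : X → Y` factors through a restriction of `B : Z → W`: there are closed subspaces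
`Z₁ ⊆ Z` and `W₁ ⊆ W` with `B Z₁ ⊆ W₁` such that `A` factors through the restricted
operator `B|_{Z₁} : Z₁ → W₁`. -/
def FactorsThroughRestriction {X Y Z W : Type*} [NormedAddCommGroup X] [NormedSpace ℝ X]
    [NormedAddCommGroup Y] [NormedSpace ℝ Y] [NormedAddCommGroup Z] [NormedSpace ℝ Z]
    [NormedAddCommGroup W] [NormedSpace ℝ W]
    (A : X →L[ℝ] Y) (B : Z →L[ℝ] W) : Prop :=
  ∃ (Z₁ : Submodule ℝ Z) (W₁ : Submodule ℝ W),
    IsClosed (Z₁ : Set Z) ∧ IsClosed (W₁ : Set W) ∧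
    ∃ h : ∀ z ∈ Z₁, B z ∈ W₁,
      ∃ (C : X →L[ℝ] ↥Z₁) (D : ↥W₁ →L[ℝ] Y),
        ∀ x, D ⟨B ((C x : ↥Z₁) : Z), h _ (C x).2⟩ = A x

/-- A class of operators between real Banach spaces. -/
def OpClass : Type 1 :=
  ∀ X Y : BanachSp, Set (X.carrier →L[ℝ] Y.carrier)

/-- The real line as a bundled Banach space. -/
def RealB : BanachSp := ⟨ℝ⟩

/-- `J` is an operator ideal in the sense of Pietsch: it has the ideal property, contains
the identity of `ℝ`, and each `J X Y` is a linear subspace. -/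
structure IsOperatorIdeal (J : OpClass) : Prop where
  comp_mem : ∀ (W X Y Z : BanachSp) (C : W.carrier →L[ℝ] X.carrier)
    (B : X.carrier →L[ℝ] Y.carrier) (A : Y.carrier →L[ℝ] Z.carrier),
    B ∈ J X Y → (A.comp (B.comp C)) ∈ J W Z
  id_mem : ContinuousLinearMap.id ℝ RealB.carrier ∈ J RealB RealB
  zero_mem : ∀ X Y : BanachSp, (0 : X.carrier →L[ℝ] Y.carrier) ∈ J X Y
  add_mem : ∀ (X Y : BanachSp) (A B : X.carrier →L[ℝ] Y.carrier),
    A ∈ J X Y → B ∈ J X Y → A + B ∈ J X Y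
  smul_mem : ∀ (X Y : BanachSp) (c : ℝ) (A : X.carrier →L[ℝ] Y.carrier),
    A ∈ J X Y → c • A ∈ J X Y

/-- A closed subspace of a Banach space, as a bundled Banach space. -/
def subSp (X : BanachSp) (Z : Submodule ℝ X.carrier) (hZ : IsClosed (Z : Set X.carrier)) :
    BanachSp :=
  letI : CompleteSpace Z := hZ.completeSpace_coe
  ⟨↥Z⟩

/-- The closure of the image `A(Z)` of a subspace `Z` under an operator `A`. -/
def imageClosure {X Y : Type*} [NormedAddCommGroup X] [NormedSpace ℝ X]
    [NormedAddCommGroup Y] [NormedSpace ℝ Y]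
    (A : X →L[ℝ] Y) (Z : Submodule ℝ X) : Submodule ℝ Y :=
  (Z.map A.toLinearMap).topologicalClosure

/-- The induced operator `A|_Z : Z → closure (A(Z))`. -/
def restrictOp {X Y : Type*} [NormedAddCommGroup X] [NormedSpace ℝ X]
    [NormedAddCommGroup Y] [NormedSpace ℝ Y]
    (A : X →L[ℝ] Y) (Z : Submodule ℝ X) : ↥Z →L[ℝ] ↥(imageClosure A Z) :=
  (A.comp Z.subtypeL).codRestrict (imageClosure A Z)
    (fun z => Submodule.le_topologicalClosure _ (Submodule.mem_map_of_mem z.2))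

/-- `J` is separably determined: `A : X → Y` belongs to `J` iff for every separable closed
subspace `Z` of `X` the induced operator `A|_Z : Z → closure (A(Z))` belongs to `J`. -/
def SeparablyDetermined (J : OpClass) : Prop :=
  ∀ (X Y : BanachSp) (A : X.carrier →L[ℝ] Y.carrier),
    A ∈ J X Y ↔
      ∀ (Z : Submodule ℝ X.carrier) (hZ : IsClosed (Z : Set X.carrier)),
        TopologicalSpace.IsSeparable (Z : Set X.carrier) →
          restrictOp A Z ∈
            J (subSp X Z hZ)
              (subSp Y (imageClosure A Z) (Submodule.isClosed_topologicalClosure _))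

/-- `J` is injective: if `j` is an isometric embedding and `j ∘ A ∈ J`, then `A ∈ J`. -/
def InjectiveIdeal (J : OpClass) : Prop :=
  ∀ (X Y Z : BanachSp) (j : Y.carrier →L[ℝ] Z.carrier),
    (∀ y, ‖j y‖ = ‖y‖) →
      ∀ A : X.carrier →L[ℝ] Y.carrier, j.comp A ∈ J X Z → A ∈ J X Y

/-- `∁J` admits a universal factoring operator. -/
def HasUniversalForComplement (J : OpClass) : Prop :=
  ∃ (E F : BanachSp) (U : E.carrier →L[ℝ] F.carrier), U ∉ J E F ∧
    ∀ (X Y : BanachSp) (A : X.carrier →L[ℝ] Y.carrier),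
      A ∉ J X Y → FactorsThrough U A

/-- There is an operator `U ∉ J` between separable Banach spaces factoring through a
restriction of every member of `∁J` between separable Banach spaces. -/
def HasSeparableRestrictedUniversal (J : OpClass) : Prop :=
  ∃ (E F : BanachSp) (U : E.carrier →L[ℝ] F.carrier),
    TopologicalSpace.SeparableSpace E.carrier ∧
    TopologicalSpace.SeparableSpace F.carrier ∧
    U ∉ J E F ∧
    ∀ (X Y : BanachSp), TopologicalSpace.SeparableSpace X.carrier →
      TopologicalSpace.SeparableSpace Y.carrier →
      ∀ A : X.carrier →L[ℝ] Y.carrier, A ∉ J X Y → FactorsThroughRestriction U A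

/-- A uniformly bounded family of functionals assembles into an operator into `ℓ^∞`. -/
lemma exists_clm_lp_infty {ι Y : Type*} [NormedAddCommGroup Y] [NormedSpace ℝ Y]
    (f : ι → Y →L[ℝ] ℝ) (K : ℝ) (hK : 0 ≤ K) (hf : ∀ i, ‖f i‖ ≤ K) :
    ∃ T : Y →L[ℝ] lp (fun _ : ι => ℝ) ⊤, (∀ y i, T y i = f i y) ∧ ‖T‖ ≤ K := by
  have hle : ∀ y i, ‖f i y‖ ≤ K * ‖y‖ := fun y i => (f i).le_of_opNorm_le (hf i) y
  let L : Y →ₗ[ℝ] lp (fun _ : ι => ℝ) ⊤ :=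
    { toFun := fun y => ⟨fun i => f i y,
        memℓp_infty ⟨K * ‖y‖, by rintro _ ⟨i, rfl⟩; exact hle y i⟩⟩
      map_add' := fun y z => by ext i; exact map_add (f i) y z
      map_smul' := fun c y => by ext i; exact map_smul (f i) c y }
  have hL : ∀ y, ‖L y‖ ≤ K * ‖y‖ := fun y =>
    lp.norm_le_of_forall_le (by positivity) (fun i => hle y i)
  exact ⟨L.mkContinuous K hL, fun y i => rfl, L.mkContinuous_norm_le hK hL⟩

/-- Every normed space embeds isometrically into some `ℓ^∞`. -/
lemma exists_isometric_clm_lp_infty (F : Type*) [NormedAddCommGroup F] [NormedSpace ℝ F] :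
    ∃ j : F →L[ℝ] lp (fun _ : F => ℝ) ⊤, ∀ y, ‖j y‖ = ‖y‖ := by
  choose g hg hgx using fun x : F => exists_dual_vector'' ℝ x
  obtain ⟨j, hj, hj1⟩ := exists_clm_lp_infty g 1 zero_le_one hg
  refine ⟨j, fun y => le_antisymm (by simpa using j.le_of_opNorm_le hj1 y) ?_⟩
  have h := lp.norm_apply_le_norm ENNReal.top_ne_zero (j y) y
  rwa [hj, hgx, RCLike.ofReal_real_eq_id, id, norm_norm] at h

/-- Operators into `ℓ^∞` extend from subspaces. -/
lemma exists_extension_lp_infty {ι Y : Type*} [NormedAddCommGroup Y] [NormedSpace ℝ Y]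
    (W : Submodule ℝ Y) (D : W →L[ℝ] lp (fun _ : ι => ℝ) ⊤) :
    ∃ T : Y →L[ℝ] lp (fun _ : ι => ℝ) ⊤, ∀ w : W, T w = D w := by
  have hle : ∀ i w, ‖D w i‖ ≤ ‖D‖ * ‖w‖ := fun i w =>
    (lp.norm_apply_le_norm ENNReal.top_ne_zero (D w) i).trans (D.le_opNorm w)
  let d : ι → W →L[ℝ] ℝ := fun i => LinearMap.mkContinuous
    { toFun := fun w => D w i
      map_add' := fun v w => by simp
      map_smul' := fun c w => by simp } ‖D‖ (hle i)
  choose g hg hgn using fun i => exists_extension_norm_eq W (d i)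
  obtain ⟨T, hT, -⟩ := exists_clm_lp_infty g ‖D‖ (norm_nonneg D) fun i => by
    rw [hgn i]
    exact LinearMap.mkContinuous_norm_le _ (norm_nonneg D) _
  refine ⟨T, fun w => ?_⟩
  ext i
  rw [hT, hg]
  rfl

lemma isSeparable_imageClosure {X Y : Type*} [NormedAddCommGroup X] [NormedSpace ℝ X]
    [NormedAddCommGroup Y] [NormedSpace ℝ Y] (A : X →L[ℝ] Y) (Z : Submodule ℝ X)
    (hZ : TopologicalSpace.IsSeparable (Z : Set X)) :
    TopologicalSpace.IsSeparable (imageClosure A Z : Set Y) :=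
  (hZ.image A.continuous).closure

/-- The restrictions to a subspace of two operators, one of which factors through the other,
satisfy the restricted factorization. -/
lemma FactorsThrough.restrictOp_factorsThroughRestriction {X Y Z W : Type*}
    [NormedAddCommGroup X] [NormedSpace ℝ X] [NormedAddCommGroup Y] [NormedSpace ℝ Y]
    [NormedAddCommGroup Z] [NormedSpace ℝ Z] [NormedAddCommGroup W] [NormedSpace ℝ W]
    {A : X →L[ℝ] Y} {B : Z →L[ℝ] W} (h : FactorsThrough A B) (S : Submodule ℝ X) :
    FactorsThroughRestriction (restrictOp A S) B := by
  obtain ⟨C, D, hCD⟩ := h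
  have hV : IsClosed (imageClosure A S : Set Y) := Submodule.isClosed_topologicalClosure _
  let W₁ : Submodule ℝ W := (imageClosure A S).comap D.toLinearMap
  have hW₁ : IsClosed (W₁ : Set W) := hV.preimage D.continuous
  refine ⟨W₁.comap B.toLinearMap, W₁, hW₁.preimage B.continuous, hW₁, fun z hz => hz,
    (C.comp S.subtypeL).codRestrict _ fun s => ?_,
    (D.comp W₁.subtypeL).codRestrict _ fun w => w.2, fun s => ?_⟩
  · change D (B (C s)) ∈ imageClosure A S
    rw [hCD]
    exact (restrictOp A S s).2
  · exact Subtype.ext (hCD s)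

/-- If `A` factors through a restriction of `restrictOp B S`, then its composition with an
operator into `ℓ^∞` factors through `B`. -/
lemma FactorsThroughRestriction.comp_lp_infty {ι X Y Z W : Type*}
    [NormedAddCommGroup X] [NormedSpace ℝ X] [NormedAddCommGroup Y] [NormedSpace ℝ Y]
    [NormedAddCommGroup Z] [NormedSpace ℝ Z] [NormedAddCommGroup W] [NormedSpace ℝ W]
    {A : X →L[ℝ] Y} {B : Z →L[ℝ] W} (S : Submodule ℝ Z)
    (h : FactorsThroughRestriction A (restrictOp B S))
    (j : Y →L[ℝ] lp (fun _ : ι => ℝ) ⊤) :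
    FactorsThrough (j.comp A) B := by
  obtain ⟨Z₁, W₁, -, -, h, C, D, hCD⟩ := h
  obtain ⟨T₁, hT₁⟩ := exists_extension_lp_infty W₁ (j.comp D)
  obtain ⟨T, hT⟩ := exists_extension_lp_infty (imageClosure B S) T₁
  refine ⟨S.subtypeL.comp (Z₁.subtypeL.comp C), T, fun x => ?_⟩
  exact (hT (restrictOp B S (C x))).trans
    ((hT₁ ⟨_, h _ (C x).2⟩).trans (congrArg j (hCD x)))

theorem statement9 (J : OpClass) (hJ : IsOperatorIdeal J) (hsd : SeparablyDetermined J) :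
    (HasUniversalForComplement J → HasSeparableRestrictedUniversal J) ∧
      (InjectiveIdeal J →
        HasSeparableRestrictedUniversal J → HasUniversalForComplement J) := by
  constructor
  · rintro ⟨E, F, U, hU, huniv⟩
    rw [hsd E F U] at hU
    push Not at hU
    obtain ⟨Z, hZ, hZs, hUZ⟩ := hU
    exact ⟨_, _, _, hZs.separableSpace, (isSeparable_imageClosure U Z hZs).separableSpace, hUZ,
      fun X Y _ _ A hA => (huniv X Y A hA).restrictOp_factorsThroughRestriction Z⟩
  · rintro hinj ⟨E, F, U, -, -, hU, huniv⟩
    obtain ⟨j, hj⟩ := exists_isometric_clm_lp_infty F.carrier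
    refine ⟨E, ⟨lp (fun _ : F.carrier => ℝ) ⊤⟩, j.comp U,
      fun h => hU (hinj E F ⟨lp (fun _ : F.carrier => ℝ) ⊤⟩ j hj U h), fun X Y A hA => ?_⟩
    rw [hsd X Y A] at hA
    push Not at hA
    obtain ⟨Z, hZ, hZs, hAZ⟩ := hA
    exact (huniv _ _ hZs.separableSpace
      (isSeparable_imageClosure A Z hZs).separableSpace _ hAZ).comp_lp_infty Z j

end
end

section
/- For each n ∈ ℕ let s_n : ℓ₁ⁿ → ℓ∞ⁿ denote the finite summing operator, defined by s_n((a_i)_{i=1}^n) = (∑_{i=1}^k a_i)_{k=1}^n, where ℓ₁ⁿ is ℝⁿ with the norm ∑|a_i| and ℓ∞ⁿ is ℝⁿ with the norm max|a_i|. Let B : X → Y be a bounded operator between real Banach spaces and suppose there is a constant c > 0 such that for every n ∈ ℕ and every closed subspace Z of X of finite codimension, s_n c-factors through the restriction B|_Z : Z → Y; that is, there exist bounded operators C : ℓ₁ⁿ → X with range contained in Z and A : Y → ℓ∞ⁿ with ‖C‖ ≤ c, ‖A‖ ≤ c and A ∘ B ∘ C = s_n. Then the operator ⊕_{n} s_n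 from the ℓ₁-sum (⊕_{n} ℓ₁ⁿ)_{ℓ₁} to the ℓ∞-sum (⊕_{n} ℓ∞ⁿ)_{ℓ∞}, defined by (x_n)_n ↦ (s_n x_n)_n, factors through B: there exist bounded operators C : (⊕_n ℓ₁ⁿ)_{ℓ₁} → X and A : Y → (⊕_n ℓ∞ⁿ)_{ℓ∞} with A(B(C x)) = (s_n x_n)_n for every x = (x_n)_n. -/
/-!
STATEMENT 11: Let `sₙ : ℓ₁ⁿ → ℓ∞ⁿ` be the finite summing operators,
`sₙ (a) = (∑_{i ≤ k} a i)_k`.  If `B : X → Y` is a bounded operator between real Banach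
spaces and there is `c > 0` such that for every `n` and every closed
finite-codimensional subspace `Z` of `X`, the operator `sₙ` `c`-factors through the
restriction `B|_Z`, then the operator `⊕ₙ sₙ : (⊕ₙ ℓ₁ⁿ)_{ℓ₁} → (⊕ₙ ℓ∞ⁿ)_{ℓ∞}`
factors through `B`.
-/

set_option synthInstance.maxHeartbeats 400000
set_option maxHeartbeats 1000000

/-- `ℓ₁ⁿ`: `ℝⁿ` with the norm `∑ |aᵢ|`. -/
abbrev ellOneFin (n : ℕ) : Type := PiLp 1 (fun _ : Fin n => ℝ)

/-- `ℓ∞ⁿ`: `ℝⁿ` with the norm `max |aᵢ|`. -/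
abbrev ellInftyFin (n : ℕ) : Type := PiLp ⊤ (fun _ : Fin n => ℝ)

/-- The finite summing operator `sₙ : ℓ₁ⁿ → ℓ∞ⁿ`, `(a i)ᵢ ↦ (∑_{i ≤ k} a i)ₖ`. -/
noncomputable def summingOp (n : ℕ) : ellOneFin n →L[ℝ] ellInftyFin n :=
  (((PiLp.continuousLinearEquiv ⊤ ℝ (fun _ : Fin n => ℝ)).symm :
        (∀ _ : Fin n, ℝ) →L[ℝ] ellInftyFin n).comp
      (ContinuousLinearMap.pi
        (fun k : Fin n => ∑ i ∈ Finset.Iic k, ContinuousLinearMap.proj i))).comp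
    ((PiLp.continuousLinearEquiv 1 ℝ (fun _ : Fin n => ℝ)) :
      ellOneFin n →L[ℝ] (∀ _ : Fin n, ℝ))

open Classical in
/-- In a finite-dimensional space, every sufficiently long bounded finite sequence has a
subsequence of length `n + 1` and of diameter at most `ε`. -/
theorem exists_orderEmbedding_norm_sub_le {E : Type*} [NormedAddCommGroup E] [NormedSpace ℝ E]
    [FiniteDimensional ℝ E] (c : ℝ) {ε : ℝ} (hε : 0 < ε) (n : ℕ) :
    ∃ N : ℕ, ∀ f : Fin N → E, (∀ j, ‖f j‖ ≤ c) →
      ∃ e : Fin (n + 1) ↪o Fin N, ∀ i j, ‖f (e i) - f (e j)‖ ≤ ε := by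
  have : ProperSpace E := FiniteDimensional.proper ℝ E
  obtain ⟨t, -, ht, hcov⟩ :=
    finite_cover_balls_of_compact (isCompact_closedBall (0 : E) c) (half_pos hε)
  refine ⟨ht.toFinset.card * n + 1, fun f hf => ?_⟩
  have hmem : ∀ j, ∃ x ∈ t, dist (f j) x < ε / 2 := fun j => by
    simpa using hcov (mem_closedBall_zero_iff.2 (hf j))
  choose g hgt hg using hmem
  obtain ⟨x, -, hx⟩ := Finset.exists_lt_card_fiber_of_mul_lt_card_of_maps_to
    (s := Finset.univ) (t := ht.toFinset) (f := g) (n := n)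
    (fun j _ => by simpa using hgt j) (by simp)
  refine ⟨Finset.orderEmbOfCardLe _ hx, fun i j => ?_⟩
  have key : ∀ i, dist (f (Finset.orderEmbOfCardLe _ hx i)) x < ε / 2 := fun i => by
    have h := (Finset.mem_filter.1 (Finset.orderEmbOfCardLe_mem _ hx i)).2
    have h' := hg (Finset.orderEmbOfCardLe _ hx i)
    rwa [h] at h'
  rw [← dist_eq_norm]
  linarith [dist_triangle_right (f (Finset.orderEmbOfCardLe _ hx i))
    (f (Finset.orderEmbOfCardLe _ hx j)) x, key i, key j]

theorem summingOp_apply (n : ℕ) (a : ellOneFin n) (k : Fin n) :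
    summingOp n a k = ∑ i ∈ Finset.Iic k, a i := by
  simp [summingOp]

/-- The map `ℓ₁ⁿ → ℓ₁ᴺ` sending the `i`-th unit vector to the `e i`-th one. -/
noncomputable def ellOneFinEmbed {n N : ℕ} (e : Fin n → Fin N) : ellOneFin n →L[ℝ] ellOneFin N :=
  LinearMap.mkContinuous
    { toFun := fun a => ∑ i, a i • PiLp.single 1 (e i) (1 : ℝ)
      map_add' := fun a b => by simp [add_smul, Finset.sum_add_distrib]
      map_smul' := fun r a => by simp [Finset.smul_sum, mul_smul] } 1
    fun a => by
      rw [one_mul, PiLp.norm_eq_of_L1 a]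
      refine (norm_sum_le Finset.univ fun i => a i • (PiLp.single 1 (e i) (1 : ℝ) : ellOneFin N)).trans
        (Finset.sum_le_sum fun i _ => ?_)
      simp [norm_smul]

theorem norm_ellOneFinEmbed_le {n N : ℕ} (e : Fin n → Fin N) : ‖ellOneFinEmbed e‖ ≤ 1 :=
  LinearMap.mkContinuous_norm_le _ zero_le_one _

theorem summingOp_ellOneFinEmbed {n N : ℕ} (e : Fin n → Fin N) (a : ellOneFin n) (k : Fin N) :
    summingOp N (ellOneFinEmbed e a) k = ∑ i, if e i ≤ k then a i else 0 := by
  have h : ellOneFinEmbed e a = ∑ i, a i • PiLp.single 1 (e i) (1 : ℝ) := rfl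
  rw [h, summingOp_apply]
  simp only [WithLp.ofLp_sum, WithLp.ofLp_smul, Finset.sum_apply, Pi.smul_apply,
    PiLp.single_apply, smul_eq_mul, mul_ite, mul_one, mul_zero]
  rw [Finset.sum_comm]
  simp

/-- The map `ℓ∞ᴺ → ℓ∞ⁿ`, `y ↦ (y (e (k + 1)) - y (e 0))ₖ`. -/
noncomputable def ellInftyFinDiff {n N : ℕ} (e : Fin (n + 1) → Fin N) :
    ellInftyFin N →ₗ[ℝ] ellInftyFin n where
  toFun y := WithLp.toLp ⊤ fun k : Fin n => y (e k.succ) - y (e 0)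
  map_add' y z := by
    ext k
    simp only [PiLp.add_apply]
    ring
  map_smul' r y := by
    ext k
    simp [mul_sub]

theorem ellInftyFinDiff_apply {n N : ℕ} (e : Fin (n + 1) → Fin N) (y : ellInftyFin N)
    (k : Fin n) : ellInftyFinDiff e y k = y (e k.succ) - y (e 0) := rfl

theorem norm_ellInftyFin_le {n : ℕ} {y : ellInftyFin n} {r : ℝ} (hr : 0 ≤ r)
    (h : ∀ k, |y k| ≤ r) : ‖y‖ ≤ r := by
  rw [← PiLp.norm_ofLp]
  exact (pi_norm_le_iff_of_nonneg hr).2 h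

theorem ellInftyFinDiff_summingOp_embed {n N : ℕ} (e : Fin (n + 1) ↪o Fin N) (a : ellOneFin n) :
    ellInftyFinDiff e (summingOp N (ellOneFinEmbed (fun i => e i.succ) a)) = summingOp n a := by
  ext k
  rw [ellInftyFinDiff_apply, summingOp_ellOneFinEmbed, summingOp_ellOneFinEmbed, summingOp_apply]
  simp only [OrderEmbedding.le_iff_le, Fin.succ_le_succ_iff, Fin.le_zero_iff, Fin.succ_ne_zero,
    if_false, Finset.sum_const_zero, sub_zero]
  rw [← Finset.sum_filter]
  congr 1
  ext i
  simp

/-- Under the factorization hypothesis, `sₙ` factors through `B` by maps into a given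
finite-codimensional subspace of `X` and vanishing on a given finite-dimensional subspace of `Y`. -/
theorem exists_factorization_vanishing
    {X Y : Type*} [NormedAddCommGroup X] [NormedSpace ℝ X]
    [NormedAddCommGroup Y] [NormedSpace ℝ Y]
    (B : X →L[ℝ] Y) (c : ℝ) (hc : 0 < c)
    (hfact : ∀ (n : ℕ) (Z : Submodule ℝ X), IsClosed (Z : Set X) →
      FiniteDimensional ℝ (X ⧸ Z) →
      ∃ (C : ellOneFin n →L[ℝ] X) (A : Y →L[ℝ] ellInftyFin n),
        (∀ e, C e ∈ Z) ∧ ‖C‖ ≤ c ∧ ‖A‖ ≤ c ∧ ∀ e, A (B (C e)) = summingOp n e)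
    (n : ℕ) (V : Submodule ℝ X) (hV : IsClosed (V : Set X)) (hVfin : V.CoFG)
    (F : Submodule ℝ Y) [FiniteDimensional ℝ F] :
    ∃ (C : ellOneFin n →L[ℝ] X) (A : Y →L[ℝ] ellInftyFin n),
      (∀ e, C e ∈ V) ∧ (∀ y ∈ F, A y = 0) ∧ ‖C‖ ≤ c ∧ ‖A‖ ≤ 2 * c + 1 ∧
        ∀ e, A (B (C e)) = summingOp n e := by
  obtain ⟨P, hP⟩ := Submodule.ClosedComplemented.of_finiteDimensional (𝕜 := ℝ) F
  have hκ : 0 < ‖P‖ + 1 := by positivity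
  obtain ⟨N, hN⟩ := exists_orderEmbedding_norm_sub_le (E := F →L[ℝ] ℝ) c (inv_pos.2 hκ) n
  obtain ⟨C, A, hCV, hC, hA, hABC⟩ := hfact N (V ⊓ (P ∘L B).ker)
    (hV.inter (P ∘L B).isClosed_ker) (hVfin.inf (Submodule.CoFG.ker _))
  obtain ⟨e, he⟩ := hN
    (fun j => (PiLp.proj ⊤ (fun _ : Fin N => ℝ) j : ellInftyFin N →L[ℝ] ℝ) ∘L A ∘L F.subtypeL)
    fun j => by
      refine ContinuousLinearMap.opNorm_le_bound _ hc.le fun y => ?_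
      exact (PiLp.norm_apply_le (A y) j).trans (A.le_of_opNorm_le hA y)
  refine ⟨C ∘L ellOneFinEmbed fun i => e i.succ,
    LinearMap.mkContinuous
      (ellInftyFinDiff e ∘ₗ (A : Y →ₗ[ℝ] ellInftyFin N) ∘ₗ
        (LinearMap.id - F.subtype ∘ₗ (P : Y →ₗ[ℝ] F))) (2 * c + 1) ?_,
    fun a => (hCV _).1, ?_, ?_, LinearMap.mkContinuous_norm_le _ (by positivity) _, ?_⟩
  · intro y
    refine norm_ellInftyFin_le (by positivity) fun k => ?_
    have h1 : ∀ j, |A y j| ≤ c * ‖y‖ := fun j =>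
      (PiLp.norm_apply_le (A y) j).trans (A.le_of_opNorm_le hA y)
    have h2 : |A (P y) (e k.succ) - A (P y) (e 0)| ≤ ‖y‖ := by
      refine (ContinuousLinearMap.le_of_opNorm_le _ (he k.succ 0) (P y)).trans ?_
      rw [inv_mul_le_iff₀ hκ]
      exact (P.le_opNorm y).trans (by gcongr; linarith)
    have h3 : (ellInftyFinDiff e ∘ₗ (A : Y →ₗ[ℝ] ellInftyFin N) ∘ₗ
        (LinearMap.id - F.subtype ∘ₗ (P : Y →ₗ[ℝ] F))) y k =
        A y (e k.succ) - A y (e 0) - (A (P y) (e k.succ) - A (P y) (e 0)) := by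
      simp [ellInftyFinDiff_apply]
    rw [h3]
    have h4 := abs_le.1 (h1 (e k.succ))
    have h5 := abs_le.1 (h1 (e 0))
    have h6 := abs_le.1 h2
    rw [abs_le]
    constructor <;> linarith
  · intro y hy
    simp [hP ⟨y, hy⟩]
  · refine (ContinuousLinearMap.opNorm_comp_le _ _).trans ?_
    nlinarith [norm_ellOneFinEmbed_le (fun i : Fin n => e i.succ), norm_nonneg C]
  · intro a
    have h : P (B (C (ellOneFinEmbed (fun i => e i.succ) a))) = 0 := (hCV _).2
    simp [h, hABC, ellInftyFinDiff_summingOp_embed]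

/-- A biorthogonal sequence of uniformly bounded factorizations of the operators `sₙ`. -/
theorem exists_biorthogonal_factorization
    {X Y : Type*} [NormedAddCommGroup X] [NormedSpace ℝ X]
    [NormedAddCommGroup Y] [NormedSpace ℝ Y]
    (B : X →L[ℝ] Y) (c : ℝ) (hc : 0 < c)
    (hfact : ∀ (n : ℕ) (Z : Submodule ℝ X), IsClosed (Z : Set X) →
      FiniteDimensional ℝ (X ⧸ Z) →
      ∃ (C : ellOneFin n →L[ℝ] X) (A : Y →L[ℝ] ellInftyFin n),
        (∀ e, C e ∈ Z) ∧ ‖C‖ ≤ c ∧ ‖A‖ ≤ c ∧ ∀ e, A (B (C e)) = summingOp n e) :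
    ∃ (C : ∀ n, ellOneFin n →L[ℝ] X) (A : ∀ n, Y →L[ℝ] ellInftyFin n),
      (∀ n, ‖C n‖ ≤ c) ∧ (∀ n, ‖A n‖ ≤ 2 * c + 1) ∧
      (∀ n e, A n (B (C n e)) = summingOp n e) ∧ ∀ m n, m ≠ n → ∀ e, A n (B (C m e)) = 0 := by
  let S := {σ : Submodule ℝ X × Submodule ℝ Y //
    IsClosed (σ.1 : Set X) ∧ σ.1.CoFG ∧ FiniteDimensional ℝ σ.2}
  have hstep : ∀ (n : ℕ) (σ : S), ∃ (C : ellOneFin n →L[ℝ] X) (A : Y →L[ℝ] ellInftyFin n),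
      (∀ e, C e ∈ σ.1.1) ∧ (∀ y ∈ σ.1.2, A y = 0) ∧ ‖C‖ ≤ c ∧ ‖A‖ ≤ 2 * c + 1 ∧
        ∀ e, A (B (C e)) = summingOp n e := fun n σ =>
    have := σ.2.2.2
    exists_factorization_vanishing B c hc hfact n σ.1.1 σ.2.1 σ.2.2.1 σ.1.2
  choose C A hCV hAF hC hA hABC using hstep
  let next : ℕ → S → S := fun n σ =>
    ⟨(σ.1.1 ⊓ (A n σ ∘L B).ker, σ.1.2 ⊔ (B ∘L C n σ).range),
      σ.2.1.inter (A n σ ∘L B).isClosed_ker, σ.2.2.1.inf (Submodule.CoFG.ker _), by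
        have := σ.2.2.2
        infer_instance⟩
  let σ : ℕ → S := fun n => Nat.rec
    ⟨(⊤, ⊥), isClosed_univ, Submodule.CoFG.top, inferInstance⟩ (fun n τ => next n τ) n
  have hσ : ∀ n, σ (n + 1) = next n (σ n) := fun _ => rfl
  have hanti : Antitone fun n => (σ n).1.1 := antitone_nat_of_succ_le fun n => by
    rw [hσ]
    exact inf_le_left
  have hmono : Monotone fun n => (σ n).1.2 := monotone_nat_of_le_succ fun n => by
    rw [hσ]
    exact le_sup_left
  refine ⟨fun n => C n (σ n), fun n => A n (σ n), fun n => hC _ _, fun n => hA _ _,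
    fun n => hABC _ _, fun m n hmn e => ?_⟩
  rcases hmn.lt_or_gt with h | h
  · refine hAF n (σ n) _ (hmono (Nat.succ_le_of_lt h) ?_)
    exact Submodule.mem_sup_right ⟨e, rfl⟩
  · have := hanti (Nat.succ_le_of_lt h) (hCV m (σ m) e)
    exact this.2

/-- A uniformly bounded sequence of operators `E n → X` induces an operator on the `ℓ₁`-sum. -/
theorem exists_clm_lp_one_hasSum {E : ℕ → Type*} [∀ n, NormedAddCommGroup (E n)]
    [∀ n, NormedSpace ℝ (E n)] {X : Type*} [NormedAddCommGroup X] [NormedSpace ℝ X]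
    [CompleteSpace X] (C : ∀ n, E n →L[ℝ] X) {c : ℝ} (hC : ∀ n, ‖C n‖ ≤ c) :
    ∃ T : ↥(lp E 1) →L[ℝ] X, ∀ x : ↥(lp E 1), HasSum (fun n => C n (x n)) (T x) := by
  have hnorm : ∀ x : ↥(lp E 1), HasSum (fun n => ‖x n‖) ‖x‖ := fun x => by
    simpa using lp.hasSum_norm (p := 1) (by simp) x
  have hle : ∀ (x : ↥(lp E 1)) n, ‖C n (x n)‖ ≤ c * ‖x n‖ := fun x n =>
    (C n).le_of_opNorm_le (hC n) _
  have hs : ∀ x : ↥(lp E 1), Summable fun n => C n (x n) := fun x =>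
    .of_norm_bounded ((hnorm x).summable.mul_left c) (hle x)
  refine ⟨LinearMap.mkContinuous
    { toFun := fun x => ∑' n, C n (x n)
      map_add' := fun x y => by
        rw [← (hs x).tsum_add (hs y)]
        simp
      map_smul' := fun r x => by
        rw [RingHom.id_apply, ← (hs x).tsum_const_smul r]
        simp } c fun x => ?_, fun x => (hs x).hasSum⟩
  exact tsum_of_norm_bounded ((hnorm x).mul_left c) (hle x)

/-- A uniformly bounded sequence of operators `Y → E n` induces an operator into the
`ℓ∞`-sum. -/
theorem exists_clm_lp_top_apply {E : ℕ → Type*} [∀ n, NormedAddCommGroup (E n)]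
    [∀ n, NormedSpace ℝ (E n)] {Y : Type*} [NormedAddCommGroup Y] [NormedSpace ℝ Y]
    (A : ∀ n, Y →L[ℝ] E n) {c : ℝ} (hA : ∀ n, ‖A n‖ ≤ c) :
    ∃ T : Y →L[ℝ] ↥(lp E ⊤), ∀ y n, T y n = A n y := by
  have hle : ∀ y n, ‖A n y‖ ≤ c * ‖y‖ := fun y n => (A n).le_of_opNorm_le (hA n) y
  have hc : 0 ≤ c := (norm_nonneg _).trans (hA 0)
  refine ⟨LinearMap.mkContinuous
    { toFun := fun y => ⟨fun n => A n y, memℓp_infty ⟨c * ‖y‖, by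
        rintro _ ⟨n, rfl⟩
        exact hle y n⟩⟩
      map_add' := fun y z => by
        ext n
        exact map_add (A n) y z
      map_smul' := fun r y => by
        ext n
        exact map_smul (A n) r y } c fun y => ?_, fun y n => rfl⟩
  exact lp.norm_le_of_forall_le (by positivity) (hle y)

theorem statement11
    {X Y : Type} [NormedAddCommGroup X] [NormedSpace ℝ X] [CompleteSpace X]
    [NormedAddCommGroup Y] [NormedSpace ℝ Y] [CompleteSpace Y]
    (B : X →L[ℝ] Y) (c : ℝ) (hc : 0 < c)
    (hfact : ∀ (n : ℕ) (Z : Submodule ℝ X), IsClosed (Z : Set X) →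
      FiniteDimensional ℝ (X ⧸ Z) →
      ∃ (C : ellOneFin n →L[ℝ] X) (A : Y →L[ℝ] ellInftyFin n),
        (∀ e, C e ∈ Z) ∧ ‖C‖ ≤ c ∧ ‖A‖ ≤ c ∧ ∀ e, A (B (C e)) = summingOp n e) :
    ∃ (C : ↥(lp ellOneFin 1) →L[ℝ] X) (A : Y →L[ℝ] ↥(lp ellInftyFin ⊤)),
      ∀ (x : ↥(lp ellOneFin 1)) (n : ℕ),
        (A (B (C x)) : ∀ n : ℕ, ellInftyFin n) n = summingOp n (x n) := by
  obtain ⟨C, A, hC, hA, hdiag, hoff⟩ := exists_biorthogonal_factorization B c hc hfact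
  obtain ⟨S, hS⟩ := exists_clm_lp_one_hasSum C hC
  obtain ⟨T, hT⟩ := exists_clm_lp_top_apply A hA
  refine ⟨S, T, fun x n => ?_⟩
  rw [hT, ← hdiag n]
  have h := (A n ∘L B).hasSum (hS x)
  exact h.unique (hasSum_single n fun m hm => hoff m n hm _)
end
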